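/- arXiv:2208.01475 — 3 statements merged into one kernel-verified Lean document; each statement's English description precedes it below -/
import Mathlib

section
/- Let α > 0 and ω > 0, and define β : ℝ → ℂ by β(y₁) := 1/(4α) + i·y₁/(2ω) (so that Re(4αβ(y₁)) = 1 > 0, and the principal branch of z ↦ z^{−1/2} is well defined and differentiable at 4αβ(y₁)). Define u : ℝ² → ℂ by u(y₁,y₂) := (4αβ(y₁))^{−1/2} · exp(−y₂²/(4β(y₁))) · exp(−iωy₁). Then u is twice continuously differentiable and satisfies the paraxial (Schrödinger-type) equation ∂²u/∂y₂²(y₁,y₂) + 2iω ∂u/∂y₁(y₁,y₂) − 2ω² u(y₁,y₂) = 0 for all (y₁,y₂) ∈ ℝ², together with the initial condition u(0,y₂) = exp(−αy₂²) for all y₂ ∈ ℝ. -/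
/-- The real part of `4αβ(y)` is `1`, where `β(y) = 1/(4α) + iy/(2ω)`. -/
lemma re_four_mul_beam_width {α : ℝ} (hα : α ≠ 0) (ω y : ℝ) :
    (4 * (α : ℂ) * (1 / (4 * (α : ℂ)) + Complex.I * y / (2 * ω))).re = 1 := by
  have hα' : (α : ℂ) ≠ 0 := by exact_mod_cast hα
  have h : 4 * (α : ℂ) * (1 / (4 * (α : ℂ)) + Complex.I * y / (2 * ω))
      = 1 + ((2 * α * y / ω : ℝ) : ℂ) * Complex.I := by
    push_cast
    rw [mul_add, mul_one_div_cancel (by simpa using hα')]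
    ring
  rw [h, Complex.add_re, Complex.re_ofReal_mul]
  simp

/-- A Gaussian beam in exponential form, using `z ^ (-1/2) = exp (-log z / 2)`. -/
lemma cpow_mul_exp_mul_exp {z : ℂ} (hz : z ≠ 0) (p a b : ℂ) :
    z ^ p * Complex.exp a * Complex.exp b = Complex.exp (Complex.log z * p + a + b) := by
  rw [Complex.cpow_def_of_ne_zero hz, Complex.exp_add, Complex.exp_add]

/-- Second derivative of `t ↦ exp (a - t²/c + b)` along the real line. -/
lemma deriv_deriv_exp_quadratic (a b c : ℂ) (y : ℝ) :
    deriv (deriv (fun t : ℝ => Complex.exp (a + -(t : ℂ) ^ 2 / c + b))) y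
      = Complex.exp (a + -(y : ℂ) ^ 2 / c + b) * ((2 * y / c) ^ 2 - 2 / c) := by
  have hof (t : ℝ) : HasDerivAt (fun t : ℝ => (t : ℂ)) 1 t := Complex.ofRealCLM.hasDerivAt
  have h1 (t : ℝ) : HasDerivAt (fun t : ℝ => Complex.exp (a + -(t : ℂ) ^ 2 / c + b))
      (Complex.exp (a + -(t : ℂ) ^ 2 / c + b) * -(2 * t / c)) t := by
    have h := (((((hof t).pow 2).neg.div_const c).const_add a).add_const b).cexp
    refine h.congr_deriv ?_
    simp only [Pi.neg_apply, Pi.pow_apply]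
    push_cast
    ring
  have h2 : deriv (fun t : ℝ => Complex.exp (a + -(t : ℂ) ^ 2 / c + b))
      = fun t : ℝ => Complex.exp (a + -(t : ℂ) ^ 2 / c + b) * -(2 * t / c) :=
    funext fun t => (h1 t).deriv
  rw [h2]
  have h := (h1 y).mul (((hof y).const_mul 2).div_const c).neg
  refine (h.congr_deriv ?_).deriv
  simp only [Pi.neg_apply]
  ring


/-- The Gaussian beam `u(y₁,y₂) = (4αβ(y₁))^{-1/2} exp(-y₂²/(4β(y₁))) exp(-iωy₁)`,
with `β(y₁) = 1/(4α) + i y₁/(2ω)`, is twice continuously differentiable, satisfies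
the paraxial equation `∂²u/∂y₂² + 2iω ∂u/∂y₁ - 2ω² u = 0`, and has initial data
`u(0,y₂) = exp(-αy₂²)`. -/
theorem gaussian_beam_paraxial (α ω : ℝ) (hα : 0 < α) (hω : 0 < ω)
    (β : ℝ → ℂ) (hβ : β = fun y₁ : ℝ => 1 / (4 * (α : ℂ)) + Complex.I * y₁ / (2 * ω))
    (u : ℝ × ℝ → ℂ)
    (hu : u = fun y : ℝ × ℝ =>
      (4 * (α : ℂ) * β y.1) ^ (-(1 / 2 : ℂ)) *
        Complex.exp (-(y.2 : ℂ) ^ 2 / (4 * β y.1)) *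
        Complex.exp (-(Complex.I * ω * y.1))) :
    ContDiff ℝ 2 u ∧
    (∀ y₁ y₂ : ℝ,
      deriv (deriv (fun t : ℝ => u (y₁, t))) y₂
        + 2 * Complex.I * ω * deriv (fun t : ℝ => u (t, y₂)) y₁
        - 2 * (ω : ℂ) ^ 2 * u (y₁, y₂) = 0) ∧
    (∀ y₂ : ℝ, u (0, y₂) = Complex.exp (-(α : ℂ) * y₂ ^ 2)) := by
  have hα' : (α : ℂ) ≠ 0 := by exact_mod_cast hα.ne'
  have hω' : (ω : ℂ) ≠ 0 := by exact_mod_cast hω.ne'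
  have hre (y : ℝ) : (4 * (α : ℂ) * β y).re = 1 := by
    rw [hβ]; exact re_four_mul_beam_width hα.ne' ω y
  have hslit (y : ℝ) : 4 * (α : ℂ) * β y ∈ Complex.slitPlane :=
    Or.inl (by rw [hre]; exact one_pos)
  have hne (y : ℝ) : 4 * (α : ℂ) * β y ≠ 0 := Complex.slitPlane_ne_zero (hslit y)
  have hβ0 (y : ℝ) : β y ≠ 0 := right_ne_zero_of_mul (hne y)
  have hu' : u = fun y : ℝ × ℝ => Complex.exp (Complex.log (4 * (α : ℂ) * β y.1) * (-(1 / 2 : ℂ))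
      + -(y.2 : ℂ) ^ 2 / (4 * β y.1) + -(Complex.I * ω * y.1)) := by
    rw [hu]
    funext y
    exact cpow_mul_exp_mul_exp (hne y.1) _ _ _
  have hof (t : ℝ) : HasDerivAt (fun t : ℝ => (t : ℂ)) 1 t := Complex.ofRealCLM.hasDerivAt
  refine ⟨?_, fun y₁ y₂ => ?_, fun y₂ => ?_⟩
  · have h1 : ContDiff ℝ 2 fun y : ℝ × ℝ => (y.1 : ℂ) := Complex.ofRealCLM.contDiff.comp contDiff_fst
    have h2 : ContDiff ℝ 2 fun y : ℝ × ℝ => (y.2 : ℂ) := Complex.ofRealCLM.contDiff.comp contDiff_snd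
    have hb : ContDiff ℝ 2 fun y : ℝ × ℝ => β y.1 := by
      rw [hβ]
      exact contDiff_const.add ((contDiff_const.mul h1).div_const _)
    have hlog : ContDiff ℝ 2 fun y : ℝ × ℝ => Complex.log (4 * (α : ℂ) * β y.1) := by
      refine contDiff_iff_contDiffAt.2 fun y => ?_
      exact ((Complex.contDiffAt_log (hslit y.1)).restrict_scalars ℝ).comp y
        (contDiff_const.mul hb).contDiffAt
    have hinv : ContDiff ℝ 2 fun y : ℝ × ℝ => (4 * β y.1)⁻¹ :=
      (contDiff_const.mul hb).inv fun y => mul_ne_zero (by norm_num) (hβ0 y.1)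
    rw [hu']
    simp only [div_eq_mul_inv (-(_ : ℂ) ^ 2)]
    exact (((hlog.mul contDiff_const).add ((h2.pow 2).neg.mul hinv)).add
      (contDiff_const.mul h1).neg).cexp
  · have hβd : HasDerivAt β (Complex.I / (2 * ω)) y₁ := by
      rw [hβ]
      exact ((((hof y₁).const_mul Complex.I).div_const (2 * (ω : ℂ))).const_add _).congr_deriv
        (by ring)
    have hd := (((((hβd.const_mul (4 * (α : ℂ))).clog_real (hslit y₁)).mul_const
      (-(1 / 2 : ℂ))).add ((hasDerivAt_const y₁ (-(y₂ : ℂ) ^ 2)).div (hβd.const_mul 4)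
        (mul_ne_zero (by norm_num) (hβ0 y₁)))).add
      ((hof y₁).const_mul (Complex.I * ω)).neg).cexp
    rw [hu']
    beta_reduce
    erw [hd.deriv]
    simp only [deriv_deriv_exp_quadratic, Pi.add_apply, Pi.neg_apply, Pi.div_apply]
    have hb := hβ0 y₁
    generalize β y₁ = b at hb ⊢
    generalize Complex.exp _ = E
    field_simp
    ring_nf
    simp only [Complex.I_sq]
    ring
  · have hβz : β 0 = 1 / (4 * (α : ℂ)) := by simp [hβ]
    have h1 : 4 * (α : ℂ) * (1 / (4 * (α : ℂ))) = 1 := by field_simp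
    have h2 : -(y₂ : ℂ) ^ 2 / (4 * (1 / (4 * (α : ℂ)))) = -(α : ℂ) * y₂ ^ 2 := by field_simp
    simp only [hu, hβz, h1, h2]
    simp
end

section
/- Let ω > 0, ε₀ > 0, μ₀ > 0. Let a = (a₁,a₂,a₃), b = (b₁,b₂,b₃) ∈ ℝ³ with aᵢ < bᵢ for each i, and let B := [a₁,b₁]×[a₂,b₂]×[a₃,b₃]. Let E, H : ℝ³ → ℂ³ be twice continuously differentiable on an open neighborhood of B and satisfy the free-space time-harmonic Maxwell relations iωε₀E − curl H = 0 and iωμ₀H + curl E = 0 there. Then for all functions q, r : ℝ³ → ℂ that are twice continuously differentiable on an open neighborhood of B, the jump functional evaluated at gradients satisfies ∮_{∂B} H·(∇q × n) dS − ∮_{∂B} E·(∇r × n) dS = iε₀ω ∮_{∂B} (E·n) q dS + iμ₀ω ∮_{∂B} (H·n) r dS, where n is the outward unit normal on ∂B. -/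
open scoped BigOperators
open MeasureTheory

/-- Partial derivative in the `i`-th coordinate of a function `f : ℝ³ → ℂ`. -/
noncomputable def pderiv3 (i : Fin 3) (f : (Fin 3 → ℝ) → ℂ) (x : Fin 3 → ℝ) : ℂ :=
  fderiv ℝ f x (Pi.single i 1)

/-- Gradient of a scalar function `q : ℝ³ → ℂ`. -/
noncomputable def grad3 (q : (Fin 3 → ℝ) → ℂ) (x : Fin 3 → ℝ) : Fin 3 → ℂ :=
  fun i => pderiv3 i q x

/-- Curl of a vector field `F : ℝ³ → ℂ³`. -/
noncomputable def curl3 (F : (Fin 3 → ℝ) → Fin 3 → ℂ) (x : Fin 3 → ℝ) : Fin 3 → ℂ :=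
  ![pderiv3 1 (fun y => F y 2) x - pderiv3 2 (fun y => F y 1) x,
    pderiv3 2 (fun y => F y 0) x - pderiv3 0 (fun y => F y 2) x,
    pderiv3 0 (fun y => F y 1) x - pderiv3 1 (fun y => F y 0) x]

/-- Boundary integral over the six faces of the box `[a₁,b₁]×[a₂,b₂]×[a₃,b₃]` of a
function `g x n` depending on the point `x` and the outward unit normal `n`. -/
noncomputable def bdryInt (a b : Fin 3 → ℝ) (g : (Fin 3 → ℝ) → (Fin 3 → ℝ) → ℂ) : ℂ :=
  (∫ y in (a 1)..(b 1), ∫ z in (a 2)..(b 2), g ![a 0, y, z] (-(Pi.single 0 1 : Fin 3 → ℝ))) +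
  (∫ y in (a 1)..(b 1), ∫ z in (a 2)..(b 2), g ![b 0, y, z] (Pi.single 0 1)) +
  (∫ x in (a 0)..(b 0), ∫ z in (a 2)..(b 2), g ![x, a 1, z] (-(Pi.single 1 1 : Fin 3 → ℝ))) +
  (∫ x in (a 0)..(b 0), ∫ z in (a 2)..(b 2), g ![x, b 1, z] (Pi.single 1 1)) +
  (∫ x in (a 0)..(b 0), ∫ y in (a 1)..(b 1), g ![x, y, a 2] (-(Pi.single 2 1 : Fin 3 → ℝ))) +
  (∫ x in (a 0)..(b 0), ∫ y in (a 1)..(b 1), g ![x, y, b 2] (Pi.single 2 1))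

section PartialDerivatives

variable {f g : (Fin 3 → ℝ) → ℂ} {U : Set (Fin 3 → ℝ)} {x : Fin 3 → ℝ}

theorem contDiffOn_pderiv3 (hU : IsOpen U) (hf : ContDiffOn ℝ 2 f U) (i : Fin 3) :
    ContDiffOn ℝ 1 (pderiv3 i f) U :=
  (hf.fderiv_of_isOpen hU (by norm_num)).clm_apply contDiffOn_const

theorem pderiv3_sub (hf : DifferentiableAt ℝ f x) (hg : DifferentiableAt ℝ g x) (i : Fin 3) :
    pderiv3 i (fun y => f y - g y) x = pderiv3 i f x - pderiv3 i g x := by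
  simp [pderiv3, fderiv_fun_sub hf hg]

theorem pderiv3_mul (hf : DifferentiableAt ℝ f x) (hg : DifferentiableAt ℝ g x) (i : Fin 3) :
    pderiv3 i (fun y => f y * g y) x = f x * pderiv3 i g x + pderiv3 i f x * g x := by
  simp [pderiv3, fderiv_fun_mul hf hg, mul_comm]

theorem pderiv3_comm (hf : ContDiffAt ℝ 2 f x) (i j : Fin 3) :
    pderiv3 i (pderiv3 j f) x = pderiv3 j (pderiv3 i f) x := by
  have hd : DifferentiableAt ℝ (fderiv ℝ f) x :=
    (hf.fderiv_right (m := 1) (by norm_num)).differentiableAt (by norm_num)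
  have key : ∀ k l : Fin 3, pderiv3 k (pderiv3 l f) x =
      fderiv ℝ (fderiv ℝ f) x (Pi.single k 1) (Pi.single l 1) := by
    intro k l
    have h := (hd.hasFDerivAt.clm_apply
      (hasFDerivAt_const (Pi.single l 1 : Fin 3 → ℝ) x)).fderiv
    change fderiv ℝ (fun y => fderiv ℝ f y (Pi.single l 1)) x (Pi.single k 1) = _
    rw [h]
    simp
  rw [key, key]
  exact (hf.isSymmSndFDerivAt (by simp)).eq _ _

end PartialDerivatives

section Curl

variable {F : (Fin 3 → ℝ) → Fin 3 → ℂ} {U : Set (Fin 3 → ℝ)} {x : Fin 3 → ℝ}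

theorem contDiffOn_curl3 (hU : IsOpen U) (hF : ContDiffOn ℝ 2 F U) :
    ContDiffOn ℝ 1 (curl3 F) U := by
  have h : ∀ i j, ContDiffOn ℝ 1 (pderiv3 i (fun y => F y j)) U := fun i j =>
    contDiffOn_pderiv3 hU (contDiffOn_pi.1 hF j) i
  refine contDiffOn_pi.2 fun i => ?_
  fin_cases i
  exacts [(h 1 2).sub (h 2 1), (h 2 0).sub (h 0 2), (h 0 1).sub (h 1 0)]

theorem div_curl3 (hU : IsOpen U) (hF : ContDiffOn ℝ 2 F U) (hx : x ∈ U) :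
    ∑ i, pderiv3 i (fun y => curl3 F y i) x = 0 := by
  have hC : ∀ j, ContDiffOn ℝ 2 (fun y => F y j) U := contDiffOn_pi.1 hF
  have hd : ∀ i j, DifferentiableAt ℝ (pderiv3 i (fun y => F y j)) x := fun i j =>
    ((contDiffOn_pderiv3 hU (hC j) i).contDiffAt (hU.mem_nhds hx)).differentiableAt (by norm_num)
  have hcomm := fun i j k => pderiv3_comm ((hC j).contDiffAt (hU.mem_nhds hx)) i k
  simp only [Fin.sum_univ_three, curl3, Matrix.cons_val]
  rw [pderiv3_sub (hd 1 2) (hd 2 1), pderiv3_sub (hd 2 0) (hd 0 2), pderiv3_sub (hd 0 1) (hd 1 0),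
    hcomm 0 2 1, hcomm 0 1 2, hcomm 1 0 2]
  ring

theorem curl3_smul {q : (Fin 3 → ℝ) → ℂ} (hq : DifferentiableAt ℝ q x)
    (hF : DifferentiableAt ℝ F x) (i : Fin 3) :
    curl3 (fun y j => q y * F y j) x i = q x * curl3 F x i - crossProduct (F x) (grad3 q x) i := by
  have h : ∀ j, DifferentiableAt ℝ (fun y => F y j) x := differentiableAt_pi.1 hF
  fin_cases i <;>
    simp [curl3, cross_apply, grad3, pderiv3_mul hq (h _)] <;> ring

end Curl

section BoundaryIntegral

variable {a b : Fin 3 → ℝ}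

theorem bdryInt_congr (hab : a ≤ b) {g h : (Fin 3 → ℝ) → (Fin 3 → ℝ) → ℂ}
    (hgh : ∀ x ∈ Set.Icc a b, ∀ n, g x n = h x n) : bdryInt a b g = bdryInt a b h := by
  have face : ∀ (i j : Fin 3) (p : ℝ → ℝ → Fin 3 → ℝ) (n : Fin 3 → ℝ),
      (∀ s ∈ Set.Icc (a i) (b i), ∀ t ∈ Set.Icc (a j) (b j), p s t ∈ Set.Icc a b) →
      (∫ s in (a i)..(b i), ∫ t in (a j)..(b j), g (p s t) n) =
        ∫ s in (a i)..(b i), ∫ t in (a j)..(b j), h (p s t) n := by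
    intro i j p n hp
    refine intervalIntegral.integral_congr fun s hs => ?_
    refine intervalIntegral.integral_congr fun t ht => ?_
    rw [Set.uIcc_of_le (hab _)] at hs ht
    exact hgh _ (hp s hs t ht) n
  have mem : ∀ {x y z : ℝ}, x ∈ Set.Icc (a 0) (b 0) → y ∈ Set.Icc (a 1) (b 1) →
      z ∈ Set.Icc (a 2) (b 2) → ![x, y, z] ∈ Set.Icc a b := by
    intro x y z hx hy hz
    constructor <;> intro i <;> fin_cases i
    exacts [hx.1, hy.1, hz.1, hx.2, hy.2, hz.2]
  have ha := fun i => Set.left_mem_Icc.2 (hab i)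
  have hb := fun i => Set.right_mem_Icc.2 (hab i)
  refine congrArg₂ (· + ·) (congrArg₂ (· + ·) (congrArg₂ (· + ·)
    (congrArg₂ (· + ·) (congrArg₂ (· + ·) ?_ ?_) ?_) ?_) ?_) ?_
  · exact face 1 2 (fun y z => ![a 0, y, z]) _ fun y hy z hz => mem (ha 0) hy hz
  · exact face 1 2 (fun y z => ![b 0, y, z]) _ fun y hy z hz => mem (hb 0) hy hz
  · exact face 0 2 (fun x z => ![x, a 1, z]) _ fun x hx z hz => mem hx (ha 1) hz
  · exact face 0 2 (fun x z => ![x, b 1, z]) _ fun x hx z hz => mem hx (hb 1) hz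
  · exact face 0 1 (fun x y => ![x, y, a 2]) _ fun x hx y hy => mem hx hy (ha 2)
  · exact face 0 1 (fun x y => ![x, y, b 2]) _ fun x hx y hy => mem hx hy (hb 2)

theorem bdryInt_const_mul (c : ℂ) (g : (Fin 3 → ℝ) → (Fin 3 → ℝ) → ℂ) :
    bdryInt a b (fun x n => c * g x n) = c * bdryInt a b g := by
  simp only [bdryInt, intervalIntegral.integral_const_mul]
  ring

theorem setIntegral_Icc_fin_two {c d : Fin 2 → ℝ} (hcd : c ≤ d) {f : (Fin 2 → ℝ) → ℂ}
    (hf : ContinuousOn f (Set.Icc c d)) :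
    ∫ y in Set.Icc c d, f y = ∫ s in (c 0)..(d 0), ∫ t in (c 1)..(d 1), f ![s, t] := by
  have hpre : (MeasurableEquiv.finTwoArrow (α := ℝ)).symm ⁻¹' Set.Icc c d =
      Set.Icc (c 0) (d 0) ×ˢ Set.Icc (c 1) (d 1) := by
    ext ⟨s, t⟩
    simp [MeasurableEquiv.finTwoArrow, Pi.le_def, Fin.forall_fin_two]
  have hmp := (volume_preserving_finTwoArrow ℝ).symm
  have hint : IntegrableOn (fun p : ℝ × ℝ => f ![p.1, p.2])
      (Set.Icc (c 0) (d 0) ×ˢ Set.Icc (c 1) (d 1)) := by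
    refine ContinuousOn.integrableOn_compact (isCompact_Icc.prod isCompact_Icc) ?_
    refine hf.comp (by fun_prop) ?_
    rintro ⟨s, t⟩ h
    simp only [Set.mem_prod, Set.mem_Icc] at h
    simp [Pi.le_def, Fin.forall_fin_two]
    tauto
  rw [← hmp.setIntegral_preimage_emb (MeasurableEquiv.measurableEmbedding _), hpre]
  change ∫ p in Set.Icc (c 0) (d 0) ×ˢ Set.Icc (c 1) (d 1), f ![p.1, p.2] = _
  rw [Measure.volume_eq_prod, setIntegral_prod _ hint, integral_Icc_eq_integral_Ioc,
    intervalIntegral.integral_of_le (hcd 0)]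
  simp only [integral_Icc_eq_integral_Ioc, intervalIntegral.integral_of_le (hcd 1)]

theorem continuousOn_comp_insertNth {G : (Fin 3 → ℝ) → Fin 3 → ℂ}
    (hG : ContinuousOn G (Set.Icc a b)) (i : Fin 3) {t : ℝ} (ht : t ∈ Set.Icc (a i) (b i)) :
    ContinuousOn (fun y : Fin 2 → ℝ => G (i.insertNth t y) i)
      (Set.Icc (a ∘ i.succAbove) (b ∘ i.succAbove)) := by
  refine ((continuous_apply i).comp_continuousOn hG).comp
    (Continuous.continuousOn (continuous_const.finInsertNth i continuous_id)) ?_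
  intro y hy
  exact Fin.insertNth_mem_Icc.2 ⟨ht, hy⟩

/-- The flux of a continuous field through the boundary of a box, as a sum over pairs of opposite
faces in the form used by the divergence theorem. -/
theorem bdryInt_flux (hab : a ≤ b) {G : (Fin 3 → ℝ) → Fin 3 → ℂ}
    (hG : ContinuousOn G (Set.Icc a b)) :
    bdryInt a b (fun x n => ∑ i, G x i * (n i : ℂ)) =
      ∑ i : Fin 3,
        ((∫ y in Set.Icc (a ∘ i.succAbove) (b ∘ i.succAbove), G (i.insertNth (b i) y) i) -
          ∫ y in Set.Icc (a ∘ i.succAbove) (b ∘ i.succAbove), G (i.insertNth (a i) y) i) := by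
  have hle : ∀ i : Fin 3, a ∘ i.succAbove ≤ b ∘ i.succAbove := fun i j => hab _
  have hf := fun i => setIntegral_Icc_fin_two (hle i)
    (continuousOn_comp_insertNth hG i (Set.right_mem_Icc.2 (hab i)))
  have hb := fun i => setIntegral_Icc_fin_two (hle i)
    (continuousOn_comp_insertNth hG i (Set.left_mem_Icc.2 (hab i)))
  have e0 : ∀ s t u : ℝ, (Fin.insertNth (0 : Fin 3) u ![s, t] : Fin 3 → ℝ) = ![u, s, t] := by
    intro s t u; ext j; fin_cases j <;> rfl
  have e1 : ∀ s t u : ℝ, (Fin.insertNth (1 : Fin 3) u ![s, t] : Fin 3 → ℝ) = ![s, u, t] := by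
    intro s t u; ext j; fin_cases j <;> rfl
  have e2 : ∀ s t u : ℝ, (Fin.insertNth (2 : Fin 3) u ![s, t] : Fin 3 → ℝ) = ![s, t, u] := by
    intro s t u; ext j; fin_cases j <;> rfl
  simp only [hf, hb, Fin.sum_univ_three, bdryInt, e0, e1, e2, Function.comp_apply]
  have s00 : (0 : Fin 3).succAbove (0 : Fin 2) = 1 := rfl
  have s01 : (0 : Fin 3).succAbove (1 : Fin 2) = 2 := rfl
  have s10 : (1 : Fin 3).succAbove (0 : Fin 2) = 0 := rfl
  have s11 : (1 : Fin 3).succAbove (1 : Fin 2) = 2 := rfl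
  have s20 : (2 : Fin 3).succAbove (0 : Fin 2) = 0 := rfl
  have s21 : (2 : Fin 3).succAbove (1 : Fin 2) = 1 := rfl
  simp [s00, s01, s10, s11, s20, s21]
  ring

theorem bdryInt_flux_sub (hab : a ≤ b) {G K : (Fin 3 → ℝ) → Fin 3 → ℂ}
    (hG : ContinuousOn G (Set.Icc a b)) (hK : ContinuousOn K (Set.Icc a b)) :
    bdryInt a b (fun x n => ∑ i, (G x i - K x i) * (n i : ℂ)) =
      bdryInt a b (fun x n => ∑ i, G x i * (n i : ℂ)) -
        bdryInt a b (fun x n => ∑ i, K x i * (n i : ℂ)) := by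
  rw [bdryInt_flux hab hG, bdryInt_flux hab hK,
    bdryInt_flux (G := fun x i => G x i - K x i) hab (hG.sub hK), ← Finset.sum_sub_distrib]
  refine Finset.sum_congr rfl fun i _ => ?_
  have hint : ∀ {L : (Fin 3 → ℝ) → Fin 3 → ℂ}, ContinuousOn L (Set.Icc a b) →
      ∀ {t}, t ∈ Set.Icc (a i) (b i) → IntegrableOn (fun y : Fin 2 → ℝ => L (i.insertNth t y) i)
        (Set.Icc (a ∘ i.succAbove) (b ∘ i.succAbove)) := fun hL _ ht =>
    (continuousOn_comp_insertNth hL i ht).integrableOn_compact isCompact_Icc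
  have ha := Set.left_mem_Icc.2 (hab i)
  have hb := Set.right_mem_Icc.2 (hab i)
  rw [integral_sub (hint hG hb) (hint hK hb), integral_sub (hint hG ha) (hint hK ha)]
  ring

/-- The flux of a curl through the boundary of a box vanishes. -/
theorem bdryInt_curl3 (hab : a ≤ b) {F : (Fin 3 → ℝ) → Fin 3 → ℂ} {U : Set (Fin 3 → ℝ)}
    (hU : IsOpen U) (hBU : Set.Icc a b ⊆ U) (hF : ContDiffOn ℝ 2 F U) :
    bdryInt a b (fun x n => ∑ i, curl3 F x i * (n i : ℂ)) = 0 := by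
  have hC := contDiffOn_curl3 hU hF
  have hCi := contDiffOn_pi.1 hC
  have hdiv : ∀ x ∈ Set.Icc a b,
      ∑ i, fderiv ℝ (fun y => curl3 F y i) x (Pi.single i 1) = 0 := fun x hx =>
    div_curl3 hU hF (hBU hx)
  rw [bdryInt_flux hab (hC.continuousOn.mono hBU),
    ← integral_divergence_of_hasFDerivAt_off_countable' a b hab (fun i x => curl3 F x i)
      (fun i x => fderiv ℝ (fun y => curl3 F y i) x) ∅ Set.countable_empty
      (fun i => (hCi i).continuousOn.mono hBU)]
  · rw [setIntegral_congr_fun measurableSet_Icc hdiv]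
    simp
  · intro x hx i
    have hxU : x ∈ U := hBU ⟨fun j => (hx.1 j trivial).1.le, fun j => (hx.1 j trivial).2.le⟩
    exact (((hCi i).contDiffAt (hU.mem_nhds hxU)).differentiableAt (by norm_num)).hasFDerivAt
  · exact integrableOn_zero.congr_fun (fun x hx => (hdiv x hx).symm) measurableSet_Icc

/-- Integration by parts on the boundary of a box: the tangential pairing of a field with a
gradient equals the weighted flux of the curl of the field. -/
theorem bdryInt_cross_grad3 (hab : a ≤ b) {F : (Fin 3 → ℝ) → Fin 3 → ℂ}
    {q : (Fin 3 → ℝ) → ℂ} {U : Set (Fin 3 → ℝ)}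
    (hU : IsOpen U) (hBU : Set.Icc a b ⊆ U) (hF : ContDiffOn ℝ 2 F U) (hq : ContDiffOn ℝ 2 q U) :
    bdryInt a b (fun x n => ∑ i, F x i * (crossProduct (grad3 q x) (fun j => (n j : ℂ))) i) =
      bdryInt a b (fun x n => (∑ i, curl3 F x i * (n i : ℂ)) * q x) := by
  have hFi := contDiffOn_pi.1 hF
  have hgrad : ∀ i, ContinuousOn (fun x => grad3 q x i) U := fun i =>
    (contDiffOn_pderiv3 hU hq i).continuousOn
  have hcross : ContinuousOn (fun x => crossProduct (F x) (grad3 q x)) (Set.Icc a b) := by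
    refine ContinuousOn.mono (continuousOn_pi.2 fun i => ?_) hBU
    have hm := fun j k => (hFi j).continuousOn.mul (hgrad k)
    fin_cases i <;> simp only [cross_apply]
    exacts [(hm 1 2).sub (hm 2 1), (hm 2 0).sub (hm 0 2), (hm 0 1).sub (hm 1 0)]
  have hcurl : ContinuousOn (fun x i => q x * curl3 F x i) (Set.Icc a b) :=
    (continuousOn_pi.2 fun i => hq.continuousOn.mul
      (contDiffOn_pi.1 (contDiffOn_curl3 hU hF) i).continuousOn).mono hBU
  have hzero := bdryInt_curl3 (F := fun y j => q y * F y j) hab hU hBU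
    (contDiffOn_pi.2 fun i => hq.mul (hFi i))
  rw [bdryInt_congr hab (h := fun x n =>
      ∑ i, (q x * curl3 F x i - crossProduct (F x) (grad3 q x) i) * (n i : ℂ)) ?_,
    bdryInt_flux_sub (G := fun x i => q x * curl3 F x i) hab hcurl hcross, sub_eq_zero] at hzero
  · have hl : (fun (x n : Fin 3 → ℝ) =>
        ∑ i, F x i * (crossProduct (grad3 q x) (fun j => (n j : ℂ))) i) =
        fun x n => ∑ i, crossProduct (F x) (grad3 q x) i * (n i : ℂ) := by
      funext x n
      simp [cross_apply, Fin.sum_univ_three]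
      ring
    rw [hl, ← hzero]
    simp only [Finset.sum_mul, mul_comm (q _), mul_right_comm]
  · intro x hx n
    have hxU := hU.mem_nhds (hBU hx)
    simp only [curl3_smul ((hq.contDiffAt hxU).differentiableAt (by norm_num))
      ((hF.contDiffAt hxU).differentiableAt (by norm_num))]

end BoundaryIntegral

/-- Box-domain, classical-regularity form of the jump form with gradient arguments:
for free-space Maxwell solutions `(E, H)`,
`∮ H·(∇q × n) - ∮ E·(∇r × n) = iε₀ω ∮ (E·n) q + iμ₀ω ∮ (H·n) r`. -/
theorem jump_form_with_gradient_arguments (ω ε₀ μ₀ : ℝ)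
    (hω : 0 < ω) (hε : 0 < ε₀) (hμ : 0 < μ₀)
    (a b : Fin 3 → ℝ) (hab : ∀ i, a i < b i)
    (E H : (Fin 3 → ℝ) → Fin 3 → ℂ)
    (U : Set (Fin 3 → ℝ)) (hU : IsOpen U) (hBU : Set.Icc a b ⊆ U)
    (hE : ContDiffOn ℝ 2 E U) (hH : ContDiffOn ℝ 2 H U)
    (hAmp : ∀ x ∈ U, ∀ i, Complex.I * ω * ε₀ * E x i - curl3 H x i = 0)
    (hFar : ∀ x ∈ U, ∀ i, Complex.I * ω * μ₀ * H x i + curl3 E x i = 0)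
    (q r : (Fin 3 → ℝ) → ℂ)
    (V : Set (Fin 3 → ℝ)) (hV : IsOpen V) (hBV : Set.Icc a b ⊆ V)
    (hq : ContDiffOn ℝ 2 q V) (hr : ContDiffOn ℝ 2 r V) :
    bdryInt a b
        (fun x n => ∑ i, H x i * (crossProduct (grad3 q x) (fun j => (n j : ℂ))) i)
      - bdryInt a b
        (fun x n => ∑ i, E x i * (crossProduct (grad3 r x) (fun j => (n j : ℂ))) i)
      = Complex.I * ε₀ * ω *
          bdryInt a b (fun x n => (∑ i, E x i * (n i : ℂ)) * q x)
        + Complex.I * μ₀ * ω *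
          bdryInt a b (fun x n => (∑ i, H x i * (n i : ℂ)) * r x) := by
  have hle : a ≤ b := fun i => (hab i).le
  have hUV := hU.inter hV
  have hB : Set.Icc a b ⊆ U ∩ V := Set.subset_inter hBU hBV
  rw [bdryInt_cross_grad3 hle hUV hB (hH.mono Set.inter_subset_left)
      (hq.mono Set.inter_subset_right),
    bdryInt_cross_grad3 hle hUV hB (hE.mono Set.inter_subset_left)
      (hr.mono Set.inter_subset_right),
    bdryInt_congr hle (g := fun x n => (∑ i, curl3 H x i * (n i : ℂ)) * q x)
      (h := fun x n => Complex.I * ε₀ * ω * ((∑ i, E x i * (n i : ℂ)) * q x)) ?_,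
    bdryInt_congr hle (g := fun x n => (∑ i, curl3 E x i * (n i : ℂ)) * r x)
      (h := fun x n => -(Complex.I * μ₀ * ω) * ((∑ i, H x i * (n i : ℂ)) * r x)) ?_,
    bdryInt_const_mul, bdryInt_const_mul]
  · ring
  · intro x hx n
    simp only [fun i => eq_neg_of_add_eq_zero_right (hFar x (hBU hx) i), Fin.sum_univ_three]
    ring
  · intro x hx n
    simp only [fun i => (sub_eq_zero.1 (hAmp x (hBU hx) i)).symm, Fin.sum_univ_three]
    ring
end

section
/- Let ω > 0 satisfy ω² ≠ (n² + m²)π² for all odd positive integers n, m. Then the family indexed by pairs (n,m) of odd positive integers given by (n,m) ↦ 1/(n·m·|(n² + m²)π² − ω²|) is summable; consequently the coefficient family a_{n,m} := 16ω/(n m π² ((n² + m²)π² − ω²)) is absolutely summable. -/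
open scoped BigOperators

/-- The reciprocals of squares of odd numbers are summable. -/
lemma summable_one_div_odd_sq : Summable (fun j : ℕ => 1 / (2 * (j : ℝ) + 1) ^ 2) := by
  have h : Summable (fun n : ℕ => 1 / (n : ℝ) ^ 2) :=
    Real.summable_one_div_nat_pow.mpr one_lt_two
  have hinj : Function.Injective (fun j : ℕ => 2 * j + 1) := fun a b hab => by
    simpa using hab
  simpa [Function.comp_def] using h.comp_injective hinj

/-- Away from a finite set of indices, the shifted eigenvalue dominates the product of the
frequencies. -/
lemma eventually_mul_le_eigenvalue_sub (c : ℝ) :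
    ∀ᶠ p : ℕ × ℕ in Filter.cofinite,
      (2 * (p.1 : ℝ) + 1) * (2 * (p.2 : ℝ) + 1) ≤
        ((2 * (p.1 : ℝ) + 1) ^ 2 + (2 * (p.2 : ℝ) + 1) ^ 2) * Real.pi ^ 2 - c := by
  obtain ⟨N, hN⟩ := exists_nat_ge c
  refine Filter.eventually_cofinite.mpr
    (((Set.finite_Iio N).prod (Set.finite_Iio N)).subset fun p hp => ?_)
  by_contra hout
  apply hp
  have hx : (0 : ℝ) ≤ p.1 := Nat.cast_nonneg _
  have hy : (0 : ℝ) ≤ p.2 := Nat.cast_nonneg _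
  have hlarge : c ≤ (2 * (p.1 : ℝ) + 1) ^ 2 + (2 * (p.2 : ℝ) + 1) ^ 2 := by
    have : N ≤ p.1 ∨ N ≤ p.2 := by
      simp only [Set.mem_prod, Set.mem_Iio] at hout
      omega
    rcases this with h | h
    · have h' : (N : ℝ) ≤ p.1 := by exact_mod_cast h
      nlinarith
    · have h' : (N : ℝ) ≤ p.2 := by exact_mod_cast h
      nlinarith
  have hpi : 2 ≤ Real.pi ^ 2 := by nlinarith [Real.pi_gt_three]
  have hmul := mul_le_mul_of_nonneg_left hpi
    (by positivity : 0 ≤ (2 * (p.1 : ℝ) + 1) ^ 2 + (2 * (p.2 : ℝ) + 1) ^ 2)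
  nlinarith [sq_nonneg ((2 * (p.1 : ℝ) + 1) - (2 * (p.2 : ℝ) + 1))]

/-- If `ω² ≠ (n² + m²)π²` for all odd positive integers `n, m`, then the family
`(n,m) ↦ 1/(nm|(n²+m²)π² - ω²|)` over pairs of odd positive integers (parametrized
as `n = 2j+1`, `m = 2k+1`) is summable, and consequently the Fourier coefficient
family `a_{n,m} = 16ω/(nmπ²((n²+m²)π² - ω²))` is absolutely summable. -/
theorem fourier_coefficients_summable (ω : ℝ) (hω : 0 < ω)
    (hres : ∀ n m : ℕ, Odd n → Odd m → 0 < n → 0 < m →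
      ω ^ 2 ≠ ((n : ℝ) ^ 2 + (m : ℝ) ^ 2) * Real.pi ^ 2) :
    Summable (fun p : ℕ × ℕ =>
      1 / ((2 * (p.1 : ℝ) + 1) * (2 * (p.2 : ℝ) + 1) *
        |((2 * (p.1 : ℝ) + 1) ^ 2 + (2 * (p.2 : ℝ) + 1) ^ 2) * Real.pi ^ 2 - ω ^ 2|)) ∧
    Summable (fun p : ℕ × ℕ =>
      |16 * ω / ((2 * (p.1 : ℝ) + 1) * (2 * (p.2 : ℝ) + 1) * Real.pi ^ 2 *
        (((2 * (p.1 : ℝ) + 1) ^ 2 + (2 * (p.2 : ℝ) + 1) ^ 2) * Real.pi ^ 2 - ω ^ 2))|) := by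
  have hsum : Summable (fun p : ℕ × ℕ =>
      1 / ((2 * (p.1 : ℝ) + 1) * (2 * (p.2 : ℝ) + 1) *
        |((2 * (p.1 : ℝ) + 1) ^ 2 + (2 * (p.2 : ℝ) + 1) ^ 2) * Real.pi ^ 2 - ω ^ 2|)) := by
    refine Summable.of_norm_bounded_eventually
      (summable_one_div_odd_sq.mul_of_nonneg summable_one_div_odd_sq
        (fun _ => by positivity) (fun _ => by positivity)) ?_
    filter_upwards [eventually_mul_le_eigenvalue_sub (ω ^ 2)] with p hp
    rw [Real.norm_of_nonneg (by positivity), one_div_mul_one_div, ← mul_pow, sq (_ * _)]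
    gcongr
    exact hp.trans (le_abs_self _)
  refine ⟨hsum, (hsum.mul_left (16 * ω / Real.pi ^ 2)).congr fun p => ?_⟩
  have hx : (0 : ℝ) < 2 * (p.1 : ℝ) + 1 := by positivity
  have hy : (0 : ℝ) < 2 * (p.2 : ℝ) + 1 := by positivity
  rw [abs_div, abs_mul (_ * _ * _), abs_of_pos (by positivity : 0 < 16 * ω),
    abs_of_pos (by positivity :
      0 < (2 * (p.1 : ℝ) + 1) * (2 * (p.2 : ℝ) + 1) * Real.pi ^ 2), div_mul_div_comm, mul_one]
  congr 1
  ring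
end
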